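/- The set of all monomials of degree 2 in k[x_1,...,x_n] is polarizable, and the set of all squarefree monomials of degree 2 is polarizable. -/

import Mathlib

noncomputable section

namespace PolarAlg

open MvPolynomial

variable (k : Type*) [Field k]

/-- The exponent vector of the degree-2 monomial attached to an edge (or loop) `e`. -/
def sym2Exp {n : ℕ} (e : Sym2 (Fin n)) : Fin n → ℕ :=
  Sym2.lift ⟨fun a b i => (if a = i then 1 else 0) + (if b = i then 1 else 0),
    fun a b => funext fun i => add_comm _ _⟩ e

/-- The monomial with exponent vector `g`. -/
def mon {n : ℕ} (g : Fin n → ℕ) : MvPolynomial (Fin n) k := ∏ i, X i ^ g i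

/-- The degree-2 monomial `f i` attached to the edge `ε i` of the graph of `f`. -/
def fmon {n : ℕ} {ι : Type*} (ε : ι → Sym2 (Fin n)) (i : ι) : MvPolynomial (Fin n) k :=
  mon k (sym2Exp (ε i))

/-- `(vtx, eidx)` is an (even, of length `2r`) closed walk in the graph `G(f)` whose edges are
indexed by `ι` via `ε` : the `j`-th edge of the walk is the edge `ε (eidx j)`, joining
`vtx j` and `vtx (j+1)`. -/
def IsWalkIn {n r : ℕ} {ι : Type*} (ε : ι → Sym2 (Fin n)) (vtx : ZMod (2 * r) → Fin n)
    (eidx : ZMod (2 * r) → ι) : Prop :=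
  ∀ j, ε (eidx j) = s(vtx j, vtx (j + 1))

/-- The exponent vector of the lcm `g` of the (distinct) edge monomials of a walk. -/
def supExp {n r : ℕ} (vtx : ZMod (2 * r) → Fin n) : Fin n → ℕ := fun l =>
  (Finset.range (2 * r)).sup fun j =>
    sym2Exp (s(vtx (j : ZMod (2 * r)), vtx ((j : ZMod (2 * r)) + 1))) l

/-- The differential syzygy `z_w` attached to an even closed walk `w = (vtx, eidx)`:
its `i`-th coordinate is the sum of the alternating terms `± g/g_j` over the positions `j`
at which the walk traverses the edge `f i`. -/
def zw {n r : ℕ} {ι : Type*} [DecidableEq ι] (ε : ι → Sym2 (Fin n))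
    (vtx : ZMod (2 * r) → Fin n) (eidx : ZMod (2 * r) → ι) : ι → MvPolynomial (Fin n) k :=
  fun i => ∑ j ∈ Finset.range (2 * r),
    if eidx (j : ZMod (2 * r)) = i then
      (-1 : MvPolynomial (Fin n) k) ^ j * mon k fun l => supExp vtx l - sym2Exp (ε i) l
    else 0

/-- The binomial `p_w = T_{w⁺} - T_{w⁻}` attached to an even closed walk. -/
def pw {r : ℕ} {ι : Type*} (eidx : ZMod (2 * r) → ι) : MvPolynomial ι k :=
  (∏ j ∈ (Finset.range (2 * r)).filter (fun j => Even j), X (eidx (j : ZMod (2 * r)))) -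
    ∏ j ∈ (Finset.range (2 * r)).filter (fun j => ¬ Even j), X (eidx (j : ZMod (2 * r)))

/-- The differential syzygy module `Z` of `f`, as the set of syzygies of the transposed
Jacobian module: vectors `a` with `∑ i, a i · df i = 0`, i.e. `∑ i, a i ∂f i/∂x l = 0`
for every `l`. -/
def Zset (n : ℕ) {ι : Type*} [Fintype ι] (ε : ι → Sym2 (Fin n)) :
    Set (ι → MvPolynomial (Fin n) k) :=
  {a | ∀ l : Fin n, ∑ i, a i * pderiv l (fmon k ε i) = 0}

/-- The generators of the polar syzygy module: the `T`-gradients of the polynomial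
relations of `f`, evaluated at `f`. -/
def polarSet (n : ℕ) {ι : Type*} [Fintype ι] (ε : ι → Sym2 (Fin n)) :
    Set (ι → MvPolynomial (Fin n) k) :=
  {v | ∃ F : MvPolynomial ι k, aeval (fmon k ε) F = 0 ∧
    v = fun i => aeval (fmon k ε) (pderiv i F)}

/-- `f` is polarizable: the polar syzygy module `P` equals the differential syzygy module
`Z` (the inclusion `P ⊆ Z` always holds, by the chain rule). -/
def Polarizable (n : ℕ) {ι : Type*} [Fintype ι] (ε : ι → Sym2 (Fin n)) : Prop :=
  Zset k n ε ⊆ ↑(Submodule.span (MvPolynomial (Fin n) k) (polarSet k n ε))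

end PolarAlg

namespace PolarAlg

open MvPolynomial

variable {k : Type*} [Field k] {n : ℕ} {ι : Type*}

/-- `sym2Exp` as a finitely supported function. -/
def edgeExp (e : Sym2 (Fin n)) : Fin n →₀ ℕ := Finsupp.equivFunOnFinite.symm (sym2Exp e)

theorem edgeExp_mk (a b : Fin n) :
    edgeExp s(a, b) = Finsupp.single a 1 + Finsupp.single b 1 := by
  ext i
  simp [edgeExp, sym2Exp, Finsupp.single_apply]

theorem fmon_eq_monomial (ε : ι → Sym2 (Fin n)) (i : ι) :
    fmon k ε i = monomial (edgeExp (ε i)) 1 := by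
  rw [monomial_eq, Finsupp.prod_fintype _ _ (by simp)]
  simp [fmon, mon, edgeExp]

/-- The vector of fine degree `m` with scalar coefficients `c`. -/
def homVec (k : Type*) [Field k] (ε : ι → Sym2 (Fin n)) (m : Fin n →₀ ℕ) :
    (ι → k) →ₗ[k] (ι → MvPolynomial (Fin n) k) :=
  LinearMap.pi fun i => monomial (m - edgeExp (ε i)) ∘ₗ LinearMap.proj i

theorem homVec_apply (ε : ι → Sym2 (Fin n)) (m : Fin n →₀ ℕ) (c : ι → k) (i : ι) :
    homVec k ε m c i = monomial (m - edgeExp (ε i)) (c i) := rfl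

theorem homVec_binomial_mem_span_polarSet [Fintype ι] [DecidableEq ι] (ε : ι → Sym2 (Fin n))
    {m : Fin n →₀ ℕ} {i₁ i₂ i₃ i₄ : ι}
    (h : edgeExp (ε i₁) + edgeExp (ε i₂) = edgeExp (ε i₃) + edgeExp (ε i₄))
    (hm : edgeExp (ε i₁) + edgeExp (ε i₂) ≤ m) :
    homVec k ε m (Pi.single i₁ 1 + Pi.single i₂ 1 - (Pi.single i₃ 1 + Pi.single i₄ 1)) ∈
      Submodule.span (MvPolynomial (Fin n) k) (polarSet k n ε) := by
  have key : homVec k ε m (Pi.single i₁ 1 + Pi.single i₂ 1 - (Pi.single i₃ 1 + Pi.single i₄ 1)) =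
      (monomial (m - (edgeExp (ε i₁) + edgeExp (ε i₂))) (1 : k)) • fun i =>
        aeval (fmon k ε) (pderiv i (X i₁ * X i₂ - X i₃ * X i₄ : MvPolynomial ι k)) := by
    obtain ⟨d, rfl⟩ := exists_add_of_le hm
    have h₁ : ∀ a b : Fin n →₀ ℕ, a + b + d - a = d + b := fun a b => by
      rw [add_assoc, add_tsub_cancel_left, add_comm]
    have h₂ : ∀ a b : Fin n →₀ ℕ, a + b + d - b = d + a := fun a b => by
      rw [add_comm a, h₁]
    have single_case : ∀ (j i : ι) (a : Fin n →₀ ℕ),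
        edgeExp (ε i₁) + edgeExp (ε i₂) + d - edgeExp (ε j) = d + a →
        (monomial (edgeExp (ε i₁) + edgeExp (ε i₂) + d - edgeExp (ε i)))
          ((Pi.single j 1 : ι → k) i) =
        monomial d 1 * (monomial a 1 *
          aeval (fmon k ε) ((Pi.single i 1 : ι → MvPolynomial ι k) j)) := by
      intro j i a ha
      by_cases hij : j = i
      · subst hij
        simp [ha, monomial_mul]
      · simp [Pi.single_eq_of_ne hij, Pi.single_eq_of_ne (Ne.symm hij)]
    funext i
    simp only [homVec_apply, Pi.add_apply, Pi.sub_apply, map_add, map_sub, Pi.smul_apply,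
      smul_eq_mul, Derivation.leibniz, pderiv_X, map_mul, aeval_X, fmon_eq_monomial, mul_add,
      mul_sub, add_tsub_cancel_left]
    rw [single_case i₁ i _ (h₁ _ _), single_case i₂ i _ (h₂ _ _),
      single_case i₃ i (edgeExp (ε i₄)) (by rw [h, h₁]),
      single_case i₄ i (edgeExp (ε i₃)) (by rw [h, h₂])]
    ring
  rw [key]
  refine Submodule.smul_mem _ _ (Submodule.subset_span ⟨_, ?_, rfl⟩)
  simp [fmon_eq_monomial, monomial_mul, h]

theorem sum_coeff_eq_zero_of_mem_Zset [Fintype ι] {ε : ι → Sym2 (Fin n)}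
    {a : ι → MvPolynomial (Fin n) k} (ha : a ∈ Zset k n ε) (m : Fin n →₀ ℕ) (l : Fin n) :
    ∑ i, coeff m (a i * monomial (edgeExp (ε i)) 1) * (edgeExp (ε i) l : k) = 0 := by
  have h := congrArg (fun p => coeff m (p * X l)) (ha l)
  simp only [Finset.sum_mul, coeff_sum, zero_mul, coeff_zero] at h
  rw [← h]
  refine Finset.sum_congr rfl fun i _ => ?_
  rw [fmon_eq_monomial, mul_assoc, mul_comm (pderiv l _), X_mul_pderiv_monomial,
    mul_smul_comm, coeff_smul, nsmul_eq_mul, mul_comm]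

theorem homVec_coeff_mul_monomial (ε : ι → Sym2 (Fin n)) (m : Fin n →₀ ℕ)
    (a : ι → MvPolynomial (Fin n) k) (i : ι) :
    homVec k ε m (fun i => coeff m (a i * monomial (edgeExp (ε i)) 1)) i *
      monomial (edgeExp (ε i)) 1 =
        monomial m (coeff m (a i * monomial (edgeExp (ε i)) 1)) := by
  rw [homVec_apply, monomial_mul, mul_one]
  by_cases h : edgeExp (ε i) ≤ m
  · rw [tsub_add_cancel_of_le h]
  · simp [coeff_mul_monomial', h]

theorem eq_sum_homVec [Fintype ι] (ε : ι → Sym2 (Fin n)) (a : ι → MvPolynomial (Fin n) k) :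
    a = ∑ m ∈ Finset.univ.biUnion fun i => (a i * monomial (edgeExp (ε i)) 1).support,
      homVec k ε m fun i => coeff m (a i * monomial (edgeExp (ε i)) 1) := by
  funext i
  have hne : (monomial (edgeExp (ε i)) (1 : k)) ≠ 0 := by simp
  refine mul_right_cancel₀ hne ?_
  rw [Finset.sum_apply, Finset.sum_mul]
  simp only [homVec_coeff_mul_monomial]
  conv_lhs => rw [← support_sum_monomial_coeff (a i * monomial (edgeExp (ε i)) 1)]
  refine Finset.sum_subset (Finset.subset_biUnion_of_mem
    (fun i => (a i * monomial (edgeExp (ε i)) 1).support) (Finset.mem_univ i)) fun m _ hm => ?_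
  rw [notMem_support_iff.mp hm, monomial_zero]

/-- Duality criterion: `f` is polarizable as soon as, in every fine degree, each functional
vanishing on the quadratic binomial relations is induced by weights on the vertices. -/
theorem polarizable_of_forall_exists_weight [Fintype ι] (ε : ι → Sym2 (Fin n))
    (H : ∀ (m : Fin n →₀ ℕ) (g : ι → k),
      (∀ i₁ i₂ i₃ i₄, edgeExp (ε i₁) + edgeExp (ε i₂) = edgeExp (ε i₃) + edgeExp (ε i₄) →
        edgeExp (ε i₁) + edgeExp (ε i₂) ≤ m → g i₁ + g i₂ = g i₃ + g i₄) →
      ∃ u : Fin n → k, ∀ i, edgeExp (ε i) ≤ m → g i = ∑ l, (edgeExp (ε i) l : k) * u l) :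
    Polarizable k n ε := by
  classical
  intro a ha
  rw [eq_sum_homVec ε a]
  refine Submodule.sum_mem _ fun m _ => ?_
  set c : ι → k := fun i => coeff m (a i * monomial (edgeExp (ε i)) 1) with hc
  let N : Submodule k (ι → k) := ((Submodule.span (MvPolynomial (Fin n) k)
    (polarSet k n ε)).restrictScalars k).comap (homVec k ε m)
  change c ∈ N
  rw [← Subspace.forall_mem_dualAnnihilator_apply_eq_zero_iff]
  intro φ hφ
  rw [Submodule.mem_dualAnnihilator] at hφ
  obtain ⟨u, hu⟩ := H m (fun i => φ (Pi.single i 1)) fun i₁ i₂ i₃ i₄ h hm => by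
    have := hφ _ (homVec_binomial_mem_span_polarSet ε h hm)
    rwa [map_sub, map_add, map_add, sub_eq_zero] at this
  have hφc : φ c = ∑ i, c i * φ (Pi.single i 1) := by
    conv_lhs => rw [pi_eq_sum_univ' c]
    simp
  have hterm : ∀ i, c i * φ (Pi.single i 1) = ∑ l, c i * (edgeExp (ε i) l : k) * u l := by
    intro i
    by_cases h : edgeExp (ε i) ≤ m
    · rw [hu i h, Finset.mul_sum]
      simp only [mul_assoc]
    · simp [hc, coeff_mul_monomial', h]
  rw [hφc, Finset.sum_congr rfl fun i _ => hterm i, Finset.sum_comm]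
  refine Finset.sum_eq_zero fun l _ => ?_
  rw [← Finset.sum_mul, sum_coeff_eq_zero_of_mem_Zset ha m l, zero_mul]

theorem sum_edgeExp_mk_mul (a b : Fin n) (u : Fin n → k) :
    ∑ l, (edgeExp s(a, b) l : k) * u l = u a + u b := by
  simp [edgeExp_mk, Finsupp.single_apply, add_mul, Finset.sum_add_distrib]

theorem edgeExp_mk_le_iff_of_ne {a b : Fin n} (hab : a ≠ b) (m : Fin n →₀ ℕ) :
    edgeExp s(a, b) ≤ m ↔ 1 ≤ m a ∧ 1 ≤ m b := by
  rw [edgeExp_mk, Finsupp.le_def]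
  simp only [Finsupp.add_apply, Finsupp.single_apply]
  refine ⟨fun h => ?_, fun h i => ?_⟩
  · have ha := h a
    have hb := h b
    simp only [hab, hab.symm, if_true, if_false] at ha hb
    omega
  · split_ifs <;> grind

theorem edgeExp_mk_self_le_iff (a : Fin n) (m : Fin n →₀ ℕ) :
    edgeExp s(a, a) ≤ m ↔ 2 ≤ m a := by
  rw [edgeExp_mk, ← Finsupp.single_add, Finsupp.single_le_iff]

section Weights

variable {V : Type*} [CharZero k] {ψ : V → V → k} {S : V → Prop}

/-- An edge weighting of a complete graph on at least three vertices that satisfies all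
four-cycle relations comes from a vertex weighting. -/
theorem exists_weight_of_three (hs : ∀ i j, ψ i j = ψ j i)
    (h4 : ∀ i j p q, S i → S j → S p → S q → i ≠ j → i ≠ p → i ≠ q → j ≠ p → j ≠ q → p ≠ q →
      ψ i j + ψ p q = ψ i p + ψ j q)
    {p q r : V} (hp : S p) (hq : S q) (hr : S r) (hpq : p ≠ q) (hpr : p ≠ r) (hqr : q ≠ r) :
    ∃ u : V → k, ∀ i j, S i → S j → i ≠ j → ψ i j = u i + u j := by
  classical
  let t := (ψ p q + ψ p r - ψ q r) / 2
  have ht : 2 * t = ψ p q + ψ p r - ψ q r := by simp [t]; ring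
  refine ⟨fun i => if i = p then t else ψ i p - t, fun i j hi hj hij => ?_⟩
  by_cases hip : i = p
  · subst hip
    simp [hij.symm, hs]
  by_cases hjp : j = p
  · subst hjp
    simp [hij]
  simp only [hip, hjp, if_false]
  suffices h : ψ i j = ψ i p + ψ j p - 2 * t by rw [h]; ring
  rw [ht]
  by_cases hiq : i = q <;> by_cases hir : i = r <;> by_cases hjq : j = q <;>
    by_cases hjr : j = r <;> grind

theorem exists_weight_of_four_cycles (hs : ∀ i j, ψ i j = ψ j i)
    (h4 : ∀ i j p q, S i → S j → S p → S q → i ≠ j → i ≠ p → i ≠ q → j ≠ p → j ≠ q → p ≠ q →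
      ψ i j + ψ p q = ψ i p + ψ j q) :
    ∃ u : V → k, ∀ i j, S i → S j → i ≠ j → ψ i j = u i + u j := by
  by_cases h3 : ∃ p q r, S p ∧ S q ∧ S r ∧ p ≠ q ∧ p ≠ r ∧ q ≠ r
  · obtain ⟨p, q, r, hp, hq, hr, hpq, hpr, hqr⟩ := h3
    exact exists_weight_of_three hs h4 hp hq hr hpq hpr hqr
  by_cases h2 : ∃ a b, S a ∧ S b ∧ a ≠ b
  · obtain ⟨a, b, ha, hb, hab⟩ := h2
    refine ⟨fun _ => ψ a b / 2, fun i j hi hj hij => ?_⟩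
    rw [add_halves]
    grind
  · exact ⟨0, fun i j hi hj hij => absurd ⟨i, j, hi, hj, hij⟩ h2⟩

theorem exists_weight_with_loops {L : V → Prop} (hLS : ∀ i, L i → S i)
    (hs : ∀ i j, ψ i j = ψ j i)
    (h4 : ∀ i j p q, S i → S j → S p → S q → i ≠ j → i ≠ p → i ≠ q → j ≠ p → j ≠ q → p ≠ q →
      ψ i j + ψ p q = ψ i p + ψ j q)
    (h1 : ∀ i p q, L i → S p → S q → i ≠ p → i ≠ q → p ≠ q → ψ i i + ψ p q = ψ i p + ψ i q)
    (h2 : ∀ i j, L i → L j → i ≠ j → ψ i i + ψ j j = ψ i j + ψ i j) :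
    ∃ u : V → k, (∀ i j, S i → S j → i ≠ j → ψ i j = u i + u j) ∧
      ∀ i, L i → ψ i i = u i + u i := by
  classical
  by_cases h3 : ∃ p q r, S p ∧ S q ∧ S r ∧ p ≠ q ∧ p ≠ r ∧ q ≠ r
  · obtain ⟨p, q, r, hp, hq, hr, hpq, hpr, hqr⟩ := h3
    obtain ⟨u, hu⟩ := exists_weight_of_three hs h4 hp hq hr hpq hpr hqr
    refine ⟨u, hu, fun i hi => ?_⟩
    obtain ⟨x, y, hx, hy, hix, hiy, hxy⟩ : ∃ x y, S x ∧ S y ∧ i ≠ x ∧ i ≠ y ∧ x ≠ y := by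
      by_cases hip : i = p
      · exact ⟨q, r, hq, hr, hip ▸ hpq, hip ▸ hpr, hqr⟩
      by_cases hiq : i = q
      · exact ⟨p, r, hp, hr, hip, hiq ▸ hqr, hpr⟩
      · exact ⟨p, q, hp, hq, hip, hiq, hpq⟩
    have h := h1 i x y hi hx hy hix hiy hxy
    rw [hu x y hx hy hxy, hu i x (hLS i hi) hx hix, hu i y (hLS i hi) hy hiy] at h
    linear_combination h
  by_cases hab : ∃ a b, S a ∧ S b ∧ a ≠ b ∧ (L b → L a)
  · obtain ⟨a, b, ha, hb, hne, hL⟩ := hab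
    have hS : ∀ i, S i → i = a ∨ i = b := by grind
    refine ⟨fun i => if i = a then ψ a a / 2 else ψ a b - ψ a a / 2, fun i j hi hj hij => ?_,
      fun i hi => ?_⟩
    · rcases hS i hi with rfl | rfl <;> rcases hS j hj with rfl | rfl
      · exact absurd rfl hij
      · simp [hij.symm]
      · simp [hij, hs]
      · exact absurd rfl hij
    · rcases hS i (hLS i hi) with rfl | rfl
      · simp
      · have h := h2 a i (hL hi) hi hne
        simp only [hne.symm, if_false]
        linear_combination h
  · refine ⟨fun i => ψ i i / 2, fun i j hi hj hij => ?_, fun i _ => (add_halves _).symm⟩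
    grind

end Weights

theorem edgeExp_mk_add_mk_swap (i j p q : Fin n) :
    edgeExp s(i, j) + edgeExp s(p, q) = edgeExp s(i, p) + edgeExp s(j, q) := by
  simp only [edgeExp_mk]
  abel

theorem edgeExp_mk_add_mk_le {i j p q : Fin n} {m : Fin n →₀ ℕ} (hi : 1 ≤ m i) (hj : 1 ≤ m j)
    (hp : 1 ≤ m p) (hq : 1 ≤ m q) (hij : i = j → 2 ≤ m i) (hpq : p = q → 2 ≤ m p)
    (hip : i ≠ p) (hiq : i ≠ q) (hjp : j ≠ p) (hjq : j ≠ q) :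
    edgeExp s(i, j) + edgeExp s(p, q) ≤ m := by
  rw [edgeExp_mk, edgeExp_mk, Finsupp.le_def]
  intro l
  simp only [Finsupp.add_apply, Finsupp.single_apply]
  split_ifs <;> grind

theorem polarizable_veronese [CharZero k] :
    Polarizable k n (id : Sym2 (Fin n) → Sym2 (Fin n)) := by
  refine polarizable_of_forall_exists_weight _ fun m g hg => ?_
  simp only [id] at hg ⊢
  obtain ⟨u, hu, hl⟩ := exists_weight_with_loops (ψ := fun i j => g s(i, j))
    (S := fun i => 1 ≤ m i) (L := fun i => 2 ≤ m i) (fun i hi => by omega)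
    (fun i j => by rw [Sym2.eq_swap])
    (fun i j p q hi hj hp hq hij hip hiq hjp hjq hpq =>
      hg _ _ _ _ (edgeExp_mk_add_mk_swap i j p q)
        (edgeExp_mk_add_mk_le hi hj hp hq (absurd · hij) (absurd · hpq) hip hiq hjp hjq))
    (fun i p q hi hp hq hip hiq hpq =>
      hg _ _ _ _ (edgeExp_mk_add_mk_swap i i p q)
        (edgeExp_mk_add_mk_le (by omega) (by omega) hp hq (fun _ => hi) (absurd · hpq)
          hip hiq hip hiq))
    (fun i j hi hj hij =>
      hg _ _ _ _ (edgeExp_mk_add_mk_swap i i j j)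
        (edgeExp_mk_add_mk_le (by omega) (by omega) (by omega) (by omega) (fun _ => hi)
          (fun _ => hj) hij hij hij hij))
  refine ⟨u, fun e he => ?_⟩
  induction e using Sym2.ind with | _ a b =>
  rw [sum_edgeExp_mk_mul]
  by_cases hab : a = b
  · subst hab
    exact hl a ((edgeExp_mk_self_le_iff a m).mp he)
  · obtain ⟨ha, hb⟩ := (edgeExp_mk_le_iff_of_ne hab m).mp he
    exact hu a b ha hb hab

theorem polarizable_squarefree_veronese [CharZero k] :
    Polarizable k n ((↑) : {e : Sym2 (Fin n) // ¬ e.IsDiag} → Sym2 (Fin n)) := by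
  classical
  refine polarizable_of_forall_exists_weight _ fun m g hg => ?_
  let g' : Sym2 (Fin n) → k := fun e => if h : e.IsDiag then 0 else g ⟨e, h⟩
  have hg' : ∀ {i j : Fin n} (h : i ≠ j), g' s(i, j) = g ⟨s(i, j), Sym2.mk_isDiag_iff.not.mpr h⟩ :=
    fun h => dif_neg _
  obtain ⟨u, hu⟩ := exists_weight_of_four_cycles (ψ := fun i j => g' s(i, j))
    (S := fun i => 1 ≤ m i) (fun i j => by rw [Sym2.eq_swap])
    (fun i j p q hi hj hp hq hij hip hiq hjp hjq hpq => by
      simp only [hg' hij, hg' hpq, hg' hip, hg' hjq]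
      exact hg _ _ _ _ (edgeExp_mk_add_mk_swap i j p q)
        (edgeExp_mk_add_mk_le hi hj hp hq (absurd · hij) (absurd · hpq) hip hiq hjp hjq))
  refine ⟨u, fun ⟨e, hd⟩ he => ?_⟩
  induction e using Sym2.ind with | _ a b =>
  have hab : a ≠ b := Sym2.mk_isDiag_iff.not.mp hd
  obtain ⟨ha, hb⟩ := (edgeExp_mk_le_iff_of_ne hab m).mp he
  rw [sum_edgeExp_mk_mul, ← hg' hab]
  exact hu a b ha hb hab

end PolarAlg

open PolarAlg in
/-- Corollary 5.1: the set of all monomials of degree 2 in `k[x_1,…,x_n]` (the 2-Veronese,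
indexed by all of `Sym2 (Fin n)`) is polarizable, and the set of all squarefree monomials of
degree 2 (indexed by the non-diagonal elements of `Sym2 (Fin n)`) is polarizable. -/
theorem veronese_and_squarefree_veronese_are_polarizable (k : Type*) [Field k] [CharZero k]
    (n : ℕ) :
    Polarizable k n (id : Sym2 (Fin n) → Sym2 (Fin n)) ∧
      Polarizable k n ((↑) : {e : Sym2 (Fin n) // ¬ e.IsDiag} → Sym2 (Fin n)) := by
  exact ⟨polarizable_veronese, polarizable_squarefree_veronese⟩
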